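/- arXiv:2202.02561 — 2 statements merged into one kernel-verified Lean document; each statement's English description precedes it below -/
import Mathlib

section
/- Assume (A). Then the functions u_λ(·) − f̲/λ converge locally uniformly on ℝⁿ, as λ → 0⁺, to a function v : ℝⁿ → ℝ which satisfies: 0 ≤ v(x) ≤ √(4‖f‖∞) · dist(x,𝔐) for all x (in particular v = 0 on 𝔐), and v is Lipschitz with constant √(4‖f‖∞). If in addition (B) holds, then v is semiconcave with constant √(2(C₁+C₂)+1), i.e. v(x+h) + v(x−h) − 2v(x) ≤ √(2(C₁+C₂)+1) |h|² for all x, h. -/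
open MeasureTheory Filter Metric Set Topology

noncomputable section

/-- `n`-dimensional Euclidean space. -/
abbrev Euc (n : ℕ) := EuclideanSpace ℝ (Fin n)

variable {n : ℕ}

/-- Trajectory of the control system `ẏ = α`, `y 0 = x`. -/
def traj (x : Euc n) (α : ℝ → Euc n) (t : ℝ) : Euc n :=
  x + ∫ s in Set.Ioc (0 : ℝ) t, α s

/-- The sup norm `‖f‖∞ = sup_x |f x|`. -/
def supNorm (f : Euc n → ℝ) : ℝ := ⨆ x, |f x|

/-- Running cost of the infinite-horizon discounted control problem. -/
def dCost (f : Euc n → ℝ) (lam : ℝ) (x : Euc n) (α : ℝ → Euc n) (t : ℝ) : ℝ :=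
  ((1 / 2) * ‖α t‖ ^ 2 + f (traj x α t)) * Real.exp (-(lam * t))

/-- Value function `u_λ` of the infinite-horizon discounted control problem:
the infimum of the total discounted cost over measurable controls (with finite cost). -/
def uLam (f : Euc n → ℝ) (lam : ℝ) (x : Euc n) : ℝ :=
  sInf {c : ℝ | ∃ α : ℝ → Euc n, Measurable α ∧
    IntegrableOn (dCost f lam x α) (Set.Ioi 0) volume ∧
    c = ∫ t in Set.Ioi (0 : ℝ), dCost f lam x α t}

/-- Running cost of the finite-horizon control problem. -/
def fCost (f : Euc n → ℝ) (x : Euc n) (α : ℝ → Euc n) (s : ℝ) : ℝ :=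
  (1 / 2) * ‖α s‖ ^ 2 + f (traj x α s)

/-- Value function `u(x,t)` of the finite-horizon control problem. -/
def uT (f : Euc n → ℝ) (x : Euc n) (t : ℝ) : ℝ :=
  sInf {c : ℝ | ∃ α : ℝ → Euc n, Measurable α ∧
    IntegrableOn (fCost f x α) (Set.Ioc 0 t) volume ∧
    c = ∫ s in Set.Ioc (0 : ℝ) t, fCost f x α s}

end

/-- A measurable control of finite discounted energy. -/
def FiniteEnergy {n : ℕ} (lam : ℝ) (α : ℝ → Euc n) : Prop :=
  Measurable α ∧ IntegrableOn (fun t => ‖α t‖ ^ 2 * Real.exp (-(lam * t))) (Ioi 0)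

lemma integrableOn_exp_neg_mul {lam : ℝ} (hlam : 0 < lam) :
    IntegrableOn (fun t : ℝ => Real.exp (-(lam * t))) (Ioi 0) := by
  simpa only [neg_mul] using integrableOn_exp_mul_Ioi (neg_lt_zero.2 hlam) 0

lemma integral_exp_neg_mul {lam : ℝ} (hlam : 0 < lam) :
    ∫ t in Ioi (0 : ℝ), Real.exp (-(lam * t)) = 1 / lam := by
  simpa [neg_mul] using integral_exp_mul_Ioi (neg_lt_zero.2 hlam) 0

section Energy

variable {n : ℕ} {lam : ℝ} {α β : ℝ → Euc n}

lemma FiniteEnergy.zero : FiniteEnergy lam (fun _ => (0 : Euc n)) :=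
  ⟨measurable_const, by simp⟩

lemma FiniteEnergy.integrableOn (hlam : 0 < lam) (hα : FiniteEnergy lam α) (t : ℝ) :
    IntegrableOn α (Ioc 0 t) := by
  have h1 : IntegrableOn
      (fun s => 1 + Real.exp (lam * t) * (‖α s‖ ^ 2 * Real.exp (-(lam * s)))) (Ioc 0 t) :=
    (integrableOn_const (by simp)).add
      ((hα.2.mono_set Ioc_subset_Ioi_self).const_mul _)
  refine Integrable.mono' h1 hα.1.aestronglyMeasurable ?_
  refine (ae_restrict_iff' measurableSet_Ioc).2 (Eventually.of_forall fun s hs => ?_)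
  have h2 : 1 ≤ Real.exp (lam * t) * Real.exp (-(lam * s)) := by
    rw [← Real.exp_add]
    refine Real.one_le_exp ?_
    nlinarith [hs.2]
  nlinarith [sq_nonneg (‖α s‖ - 1), mul_le_mul_of_nonneg_left h2 (sq_nonneg ‖α s‖)]

lemma FiniteEnergy.continuousOn_traj (hlam : 0 < lam) (hα : FiniteEnergy lam α) (x : Euc n) :
    ContinuousOn (traj x α) (Ioi 0) := by
  intro t ht
  have h : ContinuousOn (fun t => ∫ s in Ioc (0 : ℝ) t, α s) (Icc 0 (t + 1)) :=
    intervalIntegral.continuousOn_primitive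
      ((integrableOn_Icc_iff_integrableOn_Ioc (by simp)).2 (hα.integrableOn hlam (t + 1)))
  have h2 := (h.continuousAt (Icc_mem_nhds ht (by linarith)))
  exact (continuousAt_const.add h2).continuousWithinAt

lemma FiniteEnergy.add (hα : FiniteEnergy lam α) (hβ : FiniteEnergy lam β) :
    FiniteEnergy lam (fun t => α t + β t) := by
  refine ⟨hα.1.add hβ.1, Integrable.mono' ((hα.2.const_mul 2).add (hβ.2.const_mul 2))
    (((hα.1.add hβ.1).norm.pow_const 2).mul (by fun_prop)).aestronglyMeasurable
    (Eventually.of_forall fun t => ?_)⟩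
  rw [Real.norm_of_nonneg (by positivity)]
  have h : ‖α t + β t‖ ^ 2 ≤ 2 * ‖α t‖ ^ 2 + 2 * ‖β t‖ ^ 2 := by
    nlinarith [norm_add_le (α t) (β t), sq_nonneg (‖α t‖ - ‖β t‖), norm_nonneg (α t + β t)]
  calc _ ≤ (2 * ‖α t‖ ^ 2 + 2 * ‖β t‖ ^ 2) * Real.exp (-(lam * t)) := by gcongr
    _ = _ := by simp only [Pi.add_apply]; ring

lemma FiniteEnergy.mono {mu : ℝ} (h : lam ≤ mu) (hα : FiniteEnergy lam α) :
    FiniteEnergy mu α := by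
  refine ⟨hα.1, Integrable.mono' hα.2
    ((hα.1.norm.pow_const 2).mul (by fun_prop)).aestronglyMeasurable
    ((ae_restrict_iff' measurableSet_Ioi).2 (Eventually.of_forall fun t ht => ?_))⟩
  rw [Real.norm_of_nonneg (by positivity)]
  have : (0 : ℝ) ≤ t := (mem_Ioi.1 ht).le
  gcongr

end Energy

section Value

variable {n : ℕ} {g : Euc n → ℝ} {M lam : ℝ} {α : ℝ → Euc n}

lemma FiniteEnergy.integrableOn_dCost (hg : Continuous g) (hM : ∀ x, |g x| ≤ M)
    (hlam : 0 < lam) (hα : FiniteEnergy lam α) (x : Euc n) :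
    IntegrableOn (dCost g lam x α) (Ioi 0) := by
  have hmeas : AEStronglyMeasurable (fun t => g (traj x α t)) (volume.restrict (Ioi 0)) :=
    (hg.comp_continuousOn (hα.continuousOn_traj hlam x)).aestronglyMeasurable measurableSet_Ioi
  have h2 : IntegrableOn (fun t => g (traj x α t) * Real.exp (-(lam * t))) (Ioi 0) :=
    (integrableOn_exp_neg_mul hlam).bdd_mul hmeas (Eventually.of_forall fun t => hM _)
  refine ((hα.2.const_mul (1 / 2)).add h2).congr (Eventually.of_forall fun t => ?_)
  simp only [dCost, Pi.add_apply]
  ring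

lemma finiteEnergy_of_integrableOn_dCost (hM : ∀ x, |g x| ≤ M) (hlam : 0 < lam)
    (hα : Measurable α) {x : Euc n} (h : IntegrableOn (dCost g lam x α) (Ioi 0)) :
    FiniteEnergy lam α := by
  refine ⟨hα, Integrable.mono' ((h.norm.const_mul 2).add
    ((integrableOn_exp_neg_mul hlam).const_mul (2 * M)))
    ((hα.norm.pow_const 2).mul (by fun_prop)).aestronglyMeasurable
    (Eventually.of_forall fun t => ?_)⟩
  rw [Real.norm_of_nonneg (by positivity)]
  have h1 := Real.exp_pos (-(lam * t))
  have h2 := (abs_le.1 (hM (traj x α t))).1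
  have h3 := le_abs_self (dCost g lam x α t)
  simp only [Pi.add_apply, Real.norm_eq_abs]
  have h4 : dCost g lam x α t =
    ((1 / 2) * ‖α t‖ ^ 2 + g (traj x α t)) * Real.exp (-(lam * t)) := rfl
  nlinarith [mul_le_mul_of_nonneg_right h2 h1.le]

lemma le_uLam (hg : Continuous g) (hM : ∀ x, |g x| ≤ M) (hlam : 0 < lam) {x : Euc n} {b : ℝ}
    (h : ∀ α, FiniteEnergy lam α → b ≤ ∫ t in Ioi (0 : ℝ), dCost g lam x α t) :
    b ≤ uLam g lam x := by
  have h0 : FiniteEnergy lam fun _ => (0 : Euc n) := FiniteEnergy.zero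
  refine le_csInf ⟨_, _, h0.1, h0.integrableOn_dCost hg hM hlam x, rfl⟩ ?_
  rintro c ⟨α, hα, hint, rfl⟩
  exact h α (finiteEnergy_of_integrableOn_dCost hM hlam hα hint)

lemma integral_dCost_shift (hg : Continuous g) (hM : ∀ x, |g x| ≤ M) (hlam : 0 < lam)
    (hα : FiniteEnergy lam α) (x : Euc n) (a : ℝ) :
    ∫ t in Ioi (0 : ℝ), dCost (fun y => g y - a) lam x α t =
      (∫ t in Ioi (0 : ℝ), dCost g lam x α t) - a / lam := by
  have h : ∀ t, dCost (fun y => g y - a) lam x α t =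
      dCost g lam x α t - a * Real.exp (-(lam * t)) := fun t => by
    simp only [dCost]; ring
  simp_rw [h]
  rw [integral_sub (hα.integrableOn_dCost hg hM hlam x)
    ((integrableOn_exp_neg_mul hlam).const_mul a), integral_const_mul, integral_exp_neg_mul hlam,
    mul_one_div]

lemma uLam_le (hg : Continuous g) (hM : ∀ x, |g x| ≤ M) (hlam : 0 < lam)
    (hα : FiniteEnergy lam α) (x : Euc n) :
    uLam g lam x ≤ ∫ t in Ioi (0 : ℝ), dCost g lam x α t := by
  refine csInf_le ⟨-M / lam, ?_⟩ ⟨α, hα.1, hα.integrableOn_dCost hg hM hlam x, rfl⟩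
  rintro c ⟨β, hβ, hint, rfl⟩
  have hβ' := finiteEnergy_of_integrableOn_dCost hM hlam hβ hint
  have h := integral_dCost_shift hg hM hlam hβ' x (-M)
  have h2 : 0 ≤ ∫ t in Ioi (0 : ℝ), dCost (fun y => g y - -M) lam x β t := by
    refine integral_nonneg fun t => ?_
    have := (abs_le.1 (hM (traj x β t))).1
    have h3 : 0 ≤ g (traj x β t) - -M := by linarith
    simp only [dCost, Pi.zero_apply]
    positivity
  linarith

lemma uLam_shift (hg : Continuous g) (hM : ∀ x, |g x| ≤ M) (hlam : 0 < lam) (x : Euc n) (a : ℝ) :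
    uLam (fun y => g y - a) lam x = uLam g lam x - a / lam := by
  have hg' : Continuous fun y => g y - a := by fun_prop
  have hM' : ∀ x, |g x - a| ≤ M + |a| := fun x => (abs_sub _ _).trans (by linarith [hM x])
  apply le_antisymm
  · rw [le_sub_iff_add_le]
    refine le_uLam hg hM hlam fun α hα => ?_
    have := uLam_le hg' hM' hlam hα x
    rw [integral_dCost_shift hg hM hlam hα] at this
    linarith
  · refine le_uLam hg' hM' hlam fun α hα => ?_
    have := uLam_le hg hM hlam hα x
    rw [integral_dCost_shift hg hM hlam hα]
    linarith

lemma dCost_nonneg (h0 : ∀ x, 0 ≤ g x) (x : Euc n) (t : ℝ) : 0 ≤ dCost g lam x α t := by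
  have := h0 (traj x α t)
  unfold dCost
  positivity

lemma uLam_nonneg (h0 : ∀ x, 0 ≤ g x) (x : Euc n) : 0 ≤ uLam g lam x := by
  refine Real.sInf_nonneg ?_
  rintro c ⟨α, -, -, rfl⟩
  exact integral_nonneg fun t => dCost_nonneg h0 x t

lemma uLam_eq_zero (hg : Continuous g) (hM : ∀ x, |g x| ≤ M) (h0 : ∀ x, 0 ≤ g x)
    (hlam : 0 < lam) {x : Euc n} (hx : g x = 0) : uLam g lam x = 0 := by
  refine le_antisymm ((uLam_le hg hM hlam FiniteEnergy.zero x).trans_eq ?_) (uLam_nonneg h0 x)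
  simp [dCost, traj, hx]

lemma antitoneOn_uLam (hg : Continuous g) (hM : ∀ x, |g x| ≤ M) (h0 : ∀ x, 0 ≤ g x) (x : Euc n) :
    AntitoneOn (fun lam => uLam g lam x) (Ioi 0) := by
  intro lam hlam mu hmu hle
  refine le_uLam hg hM hlam fun α hα => ?_
  refine (uLam_le hg hM hmu (hα.mono hle) x).trans ?_
  refine setIntegral_mono_on ((hα.mono hle).integrableOn_dCost hg hM hmu x)
    (hα.integrableOn_dCost hg hM hlam x) measurableSet_Ioi fun t ht => ?_
  have := h0 (traj x α t)
  have : (0 : ℝ) ≤ t := (mem_Ioi.1 ht).le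
  unfold dCost
  gcongr

end Value

section Shift

variable {E : Type*} [NormedAddCommGroup E]

lemma setIntegral_comp_sub_right [NormedSpace ℝ E] (F : ℝ → E) (τ : ℝ) (s : Set ℝ) :
    ∫ t in (fun t => t - τ) ⁻¹' s, F (t - τ) = ∫ t in s, F t :=
  (measurePreserving_sub_right volume τ).setIntegral_preimage_emb
    (MeasurableEquiv.subRight τ).measurableEmbedding F s

lemma integrableOn_comp_sub_right {F : ℝ → E} (τ : ℝ) {s : Set ℝ} (hF : IntegrableOn F s) :
    IntegrableOn (fun t => F (t - τ)) ((fun t => t - τ) ⁻¹' s) :=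
  ((measurePreserving_sub_right volume τ).integrableOn_comp_preimage
    (MeasurableEquiv.subRight τ).measurableEmbedding).2 hF

end Shift

/-- The control with constant velocity `c` up to time `τ`, followed by `α`. -/
noncomputable def steer {n : ℕ} (τ : ℝ) (c : Euc n) (α : ℝ → Euc n) (t : ℝ) : Euc n :=
  if t ≤ τ then c else α (t - τ)

section Steer

variable {n : ℕ} {g : Euc n → ℝ} {M lam τ : ℝ} {α : ℝ → Euc n} {c : Euc n}

lemma FiniteEnergy.steer (hτ : 0 ≤ τ) (hα : FiniteEnergy lam α) :
    FiniteEnergy lam (steer τ c α) := by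
  refine ⟨Measurable.ite measurableSet_Iic measurable_const
    (hα.1.comp (measurable_id.sub_const τ)), ?_⟩
  rw [← Ioc_union_Ioi_eq_Ioi hτ]
  refine IntegrableOn.union ?_ ?_
  · have h : IntegrableOn (fun t => ‖c‖ ^ 2 * Real.exp (-(lam * t))) (Ioc 0 τ) :=
      (Continuous.integrableOn_Icc (by fun_prop)).mono_set Ioc_subset_Icc_self
    refine h.congr_fun (fun t ht => ?_) measurableSet_Ioc
    simp [_root_.steer, ht.2]
  · have h := (integrableOn_comp_sub_right τ hα.2).const_mul (Real.exp (-(lam * τ)))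
    simp only [preimage_sub_const_Ioi, zero_add] at h
    refine IntegrableOn.congr_fun h (fun t ht => ?_) measurableSet_Ioi
    have h2 : Real.exp (-(lam * t)) = Real.exp (-(lam * τ)) * Real.exp (-(lam * (t - τ))) := by
      rw [← Real.exp_add]; congr 1; ring
    simp only [_root_.steer, not_le.2 (mem_Ioi.1 ht), if_false, h2]
    ring

lemma traj_steer (hlam : 0 < lam) (hα : FiniteEnergy lam α) (hτ : 0 ≤ τ) (x : Euc n) {t : ℝ}
    (ht : τ < t) : traj x (steer τ c α) t = traj (x + τ • c) α (t - τ) := by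
  have hint := (hα.steer (c := c) hτ).integrableOn hlam t
  have h1 : ∫ s in Ioc 0 τ, steer τ c α s = τ • c := by
    rw [setIntegral_congr_fun (g := fun _ => c) measurableSet_Ioc
      (fun s hs => by simp [steer, hs.2])]
    simp [hτ]
  have h2 : ∫ s in Ioc τ t, steer τ c α s = ∫ s in Ioc 0 (t - τ), α s := by
    rw [setIntegral_congr_fun (g := fun s => α (s - τ)) measurableSet_Ioc
      (fun s hs => by simp [steer, not_le.2 hs.1]), ← setIntegral_comp_sub_right α τ]
    simp
  unfold traj
  rw [← Ioc_union_Ioc_eq_Ioc hτ ht.le, setIntegral_union (Ioc_disjoint_Ioc_of_le le_rfl)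
    measurableSet_Ioc (hint.mono_set (Ioc_subset_Ioc_right ht.le))
    (hint.mono_set (Ioc_subset_Ioc_left hτ)), h1, h2, add_assoc]

lemma uLam_le_steer (hg : Continuous g) (h0 : ∀ x, 0 ≤ g x) (hM : ∀ x, g x ≤ M) (hlam : 0 < lam)
    (hτ : 0 ≤ τ) (x c : Euc n) :
    uLam g lam x ≤ τ * ((1 / 2) * ‖c‖ ^ 2 + M) + uLam g lam (x + τ • c) := by
  have hM' : ∀ x, |g x| ≤ M := fun x => by rw [abs_of_nonneg (h0 x)]; exact hM x
  rw [← sub_le_iff_le_add']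
  refine le_uLam hg hM' hlam fun α hα => ?_
  have hβ : FiniteEnergy lam (steer τ c α) := hα.steer hτ
  have hle := uLam_le hg hM' hlam hβ x
  have hint := hβ.integrableOn_dCost hg hM' hlam x
  have hintα := integrableOn_comp_sub_right τ (hα.integrableOn_dCost hg hM' hlam (x + τ • c))
  simp only [preimage_sub_const_Ioi, zero_add] at hintα
  rw [← Ioc_union_Ioi_eq_Ioi hτ, setIntegral_union Ioc_disjoint_Ioi_same measurableSet_Ioi
    (hint.mono_set Ioc_subset_Ioi_self) (hint.mono_set (Ioi_subset_Ioi hτ))] at hle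
  have h1 : ∫ t in Ioc 0 τ, dCost g lam x (steer τ c α) t ≤ τ * ((1 / 2) * ‖c‖ ^ 2 + M) := by
    have : ∫ t in Ioc 0 τ, ((1 / 2) * ‖c‖ ^ 2 + M) = τ * ((1 / 2) * ‖c‖ ^ 2 + M) := by
      simp [hτ]
    rw [← this]
    refine setIntegral_mono_on (hint.mono_set Ioc_subset_Ioi_self) (integrableOn_const (by simp))
      measurableSet_Ioc fun t ht => ?_
    have hy := h0 (traj x (steer τ c α) t)
    have hy' := hM (traj x (steer τ c α) t)
    have hexp : Real.exp (-(lam * t)) ≤ 1 :=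
      Real.exp_le_one_iff.2 (neg_nonpos.2 (mul_nonneg hlam.le ht.1.le))
    have hst : steer τ c α t = c := by simp [steer, ht.2]
    simp only [dCost, hst]
    refine (mul_le_of_le_one_right (by positivity) hexp).trans (by linarith)
  have h2 : ∫ t in Ioi τ, dCost g lam x (steer τ c α) t ≤
      ∫ t in Ioi 0, dCost g lam (x + τ • c) α t := by
    rw [← setIntegral_comp_sub_right _ τ (Ioi 0)]
    simp only [preimage_sub_const_Ioi, zero_add]
    refine setIntegral_mono_on (hint.mono_set (Ioi_subset_Ioi hτ)) hintα measurableSet_Ioi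
      fun t ht => ?_
    have hst : steer τ c α t = α (t - τ) := by simp [steer, not_le.2 (mem_Ioi.1 ht)]
    have hy := h0 (traj (x + τ • c) α (t - τ))
    simp only [dCost, hst, traj_steer hlam hα hτ x ht]
    gcongr
    linarith
  linarith

lemma uLam_le_add_mul_dist (hg : Continuous g) (h0 : ∀ x, 0 ≤ g x) (hM : ∀ x, g x ≤ M)
    (hlam : 0 < lam) (x y : Euc n) :
    uLam g lam x ≤ uLam g lam y + √(2 * M) * dist x y := by
  rcases eq_or_ne x y with rfl | hxy
  · simp
  have hM0 : 0 ≤ M := (h0 x).trans (hM x)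
  have hd : 0 < dist x y := dist_pos.2 hxy
  refine le_of_forall_pos_le_add fun ε hε => ?_
  set s := √(2 * M) + ε / dist x y with hs
  have hεd : 0 < ε / dist x y := by positivity
  have hspos : 0 < s := by positivity
  have hMs : 2 * M ≤ s ^ 2 := by
    rw [← Real.sq_sqrt (by positivity : 0 ≤ 2 * M)]
    gcongr
    linarith
  have h := uLam_le_steer hg h0 hM hlam (τ := dist x y / s) (by positivity) x
    ((s / dist x y) • (y - x))
  have e1 : (dist x y / s) • (s / dist x y) • (y - x) = y - x := by
    rw [smul_smul, div_mul_div_cancel₀ hspos.ne', div_self hd.ne', one_smul]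
  have e2 : ‖(s / dist x y) • (y - x)‖ = s := by
    rw [norm_smul, ← dist_eq_norm, dist_comm y x, Real.norm_of_nonneg (by positivity),
      div_mul_cancel₀ _ hd.ne']
  rw [e1, e2, add_sub_cancel] at h
  have h3 : dist x y / s * (1 / 2 * s ^ 2 + M) ≤ dist x y / s * s ^ 2 := by
    gcongr
    linarith
  have h4 : dist x y / s * s ^ 2 = √(2 * M) * dist x y + ε := by
    rw [pow_two, ← mul_assoc, div_mul_cancel₀ _ hspos.ne', hs]
    field_simp
  linarith

end Steer

section Semiconcave

variable {n : ℕ} {g : Euc n → ℝ} {M lam k : ℝ} {α : ℝ → Euc n}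

lemma setIntegral_Ioc_mul_exp {t : ℝ} (ht : 0 ≤ t) :
    ∫ s in Ioc 0 t, k * Real.exp (-(k * s)) = 1 - Real.exp (-(k * t)) := by
  rw [← intervalIntegral.integral_of_le ht,
    intervalIntegral.integral_eq_sub_of_hasDerivAt (f := fun s => -Real.exp (-(k * s)))]
  · simp; ring
  · intro s _
    have h : HasDerivAt (fun s => -(k * s)) (-(k * 1)) s := ((hasDerivAt_id' s).const_mul k).fun_neg
    exact h.exp.fun_neg.congr_deriv (by ring)
  · exact Continuous.intervalIntegrable (by fun_prop) _ _

lemma finiteEnergy_exp (hlam : 0 < lam) (hk : 0 < k) (h : Euc n) :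
    FiniteEnergy lam (fun t => -((k * Real.exp (-(k * t))) • h)) := by
  refine ⟨by fun_prop, ?_⟩
  have h1 := (integrableOn_exp_neg_mul (lam := 2 * k + lam) (by positivity)).const_mul
    (k ^ 2 * ‖h‖ ^ 2)
  refine IntegrableOn.congr_fun h1 (fun t _ => ?_) measurableSet_Ioi
  have e : Real.exp (-((2 * k + lam) * t)) =
      Real.exp (-(k * t)) ^ 2 * Real.exp (-(lam * t)) := by
    rw [pow_two, ← Real.exp_add, ← Real.exp_add]; congr 1; ring
  simp only [norm_neg, norm_smul, e, Real.norm_eq_abs, mul_pow, sq_abs]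
  ring

lemma traj_add_exp (hlam : 0 < lam) (hα : FiniteEnergy lam α) (x h : Euc n) {t : ℝ} (ht : 0 ≤ t) :
    traj (x + h) (fun t => α t + -((k * Real.exp (-(k * t))) • h)) t =
      traj x α t + Real.exp (-(k * t)) • h := by
  have hint : IntegrableOn (fun t => (k * Real.exp (-(k * t))) • h) (Ioc 0 t) :=
    (Continuous.integrableOn_Icc (by fun_prop)).mono_set Ioc_subset_Icc_self
  unfold traj
  rw [integral_add (hα.integrableOn hlam t) hint.fun_neg, integral_neg, integral_smul_const,
    setIntegral_Ioc_mul_exp ht]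
  module

lemma uLam_semiconcave (hg : Continuous g) (hM : ∀ x, |g x| ≤ M) (hlam : 0 < lam) (hk : 0 < k)
    {C : ℝ} (hCk : C ≤ k ^ 2)
    (hsc : ∀ x h, g (x + h) + g (x - h) - 2 * g x ≤ C * ‖h‖ ^ 2) (x h : Euc n) :
    uLam g lam (x + h) + uLam g lam (x - h) - 2 * uLam g lam x ≤ k * ‖h‖ ^ 2 := by
  suffices hs : (uLam g lam (x + h) + uLam g lam (x - h) - k * ‖h‖ ^ 2) / 2 ≤ uLam g lam x by
    linarith
  refine le_uLam hg hM hlam fun α hα => ?_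
  have hp := hα.add (finiteEnergy_exp hlam hk h)
  have hm := hα.add (finiteEnergy_exp hlam hk (-h))
  have hp1 := uLam_le hg hM hlam hp (x + h)
  have hm1 := uLam_le hg hM hlam hm (x + -h)
  rw [← sub_eq_add_neg] at hm1
  have hpI := hp.integrableOn_dCost hg hM hlam (x + h)
  have hmI := hm.integrableOn_dCost hg hM hlam (x + -h)
  rw [← sub_eq_add_neg] at hmI
  have hαI := hα.integrableOn_dCost hg hM hlam x
  have hEI := (integrableOn_exp_neg_mul (lam := 2 * k) (by positivity)).const_mul
    (2 * k ^ 2 * ‖h‖ ^ 2)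
  have hkey := setIntegral_mono_on (hpI.add hmI) ((hαI.const_mul 2).add hEI) measurableSet_Ioi
    fun t ht => ?_
  · simp only [Pi.add_apply] at hkey
    rw [integral_add hpI hmI, integral_add (hαI.const_mul 2) hEI, integral_const_mul,
      integral_const_mul, integral_exp_neg_mul (by positivity)] at hkey
    have e : 2 * k ^ 2 * ‖h‖ ^ 2 * (1 / (2 * k)) = k * ‖h‖ ^ 2 := by field_simp
    linarith
  · have ht' : (0 : ℝ) ≤ t := (mem_Ioi.1 ht).le
    have e1 := traj_add_exp (k := k) hlam hα x h ht'
    have e2 := traj_add_exp (k := k) hlam hα x (-h) ht'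
    rw [← sub_eq_add_neg] at e2
    have e3 : Real.exp (-(2 * k * t)) = Real.exp (-(k * t)) ^ 2 := by
      rw [pow_two, ← Real.exp_add]; congr 1; ring
    simp only [Pi.add_apply, dCost, e1, e2, e3]
    set q := Real.exp (-(k * t)) with hq
    set y := traj x α t
    have hs := hsc y (q • h)
    have hpar := parallelogram_law_with_norm ℝ (α t) ((k * q) • h)
    simp only [smul_neg, neg_neg, ← sub_eq_add_neg]
    have n1 : ‖(k * q) • h‖ ^ 2 = k ^ 2 * (q ^ 2 * ‖h‖ ^ 2) := by
      rw [norm_smul, Real.norm_of_nonneg (by positivity)]; ring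
    have n2 : ‖q • h‖ ^ 2 = q ^ 2 * ‖h‖ ^ 2 := by
      rw [norm_smul, Real.norm_of_nonneg (by positivity)]; ring
    rw [n2] at hs
    set w := q ^ 2 * ‖h‖ ^ 2 with hw
    have hw0 : 0 ≤ w := by positivity
    have hexp : Real.exp (-(lam * t)) ≤ 1 :=
      Real.exp_le_one_iff.2 (neg_nonpos.2 (mul_nonneg hlam.le ht'))
    have hexp0 := Real.exp_pos (-(lam * t))
    set E := Real.exp (-(lam * t))
    have hCw : C * w ≤ k ^ 2 * w := by gcongr
    calc _ = (1 / 2 * (‖α t + (k * q) • h‖ ^ 2 + ‖α t - (k * q) • h‖ ^ 2)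
            + (g (y + q • h) + g (y - q • h))) * E := by ring
      _ ≤ (‖α t‖ ^ 2 + 2 * g y + 2 * (k ^ 2 * w)) * E := by
          refine mul_le_mul_of_nonneg_right ?_ hexp0.le
          rw [hpar, n1]
          linarith
      _ = 2 * ((1 / 2 * ‖α t‖ ^ 2 + g y) * E) + 2 * (k ^ 2 * w) * E := by ring
      _ ≤ 2 * ((1 / 2 * ‖α t‖ ^ 2 + g y) * E) + 2 * (k ^ 2 * w) := by
          have := mul_le_of_le_one_right (by positivity : 0 ≤ 2 * (k ^ 2 * w)) hexp
          linarith
      _ = _ := by rw [hw]; ring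

end Semiconcave

/-- under assumptions (A), `u_lam - flo/lam` converges locally uniformly
as `lam → 0⁺` to a function `v` with `0 ≤ v(x) ≤ √(4‖f‖∞) dist(x,𝔐)` (so `v = 0` on `𝔐`),
`v` is `√(4‖f‖∞)`-Lipschitz, and under the additional assumptions (B) `v` is semiconcave
with constant `√(2(C₁+C₂)+1)`. -/
theorem stmt3 {n : ℕ} (f : Euc n → ℝ) (flo fhi : ℝ)
    (hcont : Continuous f) (hlo : ∀ x, flo ≤ f x) (hhi : ∀ x, f x ≤ fhi)
    (hattain : ∃ x, f x = flo) :
    ∃ v : Euc n → ℝ,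
      TendstoLocallyUniformly (fun (lam : ℝ) (x : Euc n) => uLam f lam x - flo / lam) v
        (𝓝[>] (0 : ℝ)) ∧
      (∀ x : Euc n,
        0 ≤ v x ∧ v x ≤ Real.sqrt (4 * supNorm f) * Metric.infDist x {z : Euc n | f z = flo}) ∧
      (∀ x y : Euc n, |v x - v y| ≤ Real.sqrt (4 * supNorm f) * dist x y) ∧
      (∀ C1 C2 : ℝ, (∀ x y : Euc n, |f x - f y| ≤ C1 * dist x y) →
        (∀ x h : Euc n, f (x + h) + f (x - h) - 2 * f x ≤ C2 * ‖h‖ ^ 2) →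
        ∀ x h : Euc n, v (x + h) + v (x - h) - 2 * v x
          ≤ Real.sqrt (2 * (C1 + C2) + 1) * ‖h‖ ^ 2) := by
  have habs : ∀ x, |f x| ≤ max |flo| |fhi| := fun x => abs_le_max_abs_abs (hlo x) (hhi x)
  have hS : ∀ x, |f x| ≤ supNorm f := fun x =>
    le_ciSup (f := fun x => |f x|) ⟨_, forall_mem_range.2 habs⟩ x
  obtain ⟨z₀, hz₀⟩ := hattain
  set g : Euc n → ℝ := fun y => f y - flo with hgdef
  have hg : Continuous g := by fun_prop
  have h0 : ∀ x, 0 ≤ g x := fun x => sub_nonneg.2 (hlo x)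
  have hgM : ∀ x, g x ≤ 2 * supNorm f := fun x => by
    have h1 := (abs_le.1 (hS x)).2
    have h2 := (abs_le.1 (hS z₀)).1
    simp only [hgdef]
    linarith
  have hgabs : ∀ x, |g x| ≤ 2 * supNorm f := fun x => by
    rw [abs_of_nonneg (h0 x)]; exact hgM x
  set L := Real.sqrt (4 * supNorm f) with hL
  have hL0 : 0 ≤ L := Real.sqrt_nonneg _
  have hlip : ∀ lam, 0 < lam → ∀ x y, uLam g lam x ≤ uLam g lam y + L * dist x y := by
    intro lam hlam x y
    have h := uLam_le_add_mul_dist hg h0 hgM hlam x y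
    rwa [← mul_assoc, show (2 : ℝ) * 2 = 4 by norm_num] at h
  have hzero : ∀ lam, 0 < lam → ∀ z, f z = flo → uLam g lam z = 0 := fun lam hlam z hz =>
    uLam_eq_zero hg hgabs h0 hlam (by simp [hgdef, hz])
  have hbdd : ∀ x, BddAbove ((fun lam => uLam g lam x) '' Ioi 0) := by
    refine fun x => ⟨L * dist x z₀, ?_⟩
    rintro _ ⟨lam, hlam, rfl⟩
    simpa [hzero lam hlam z₀ hz₀] using hlip lam hlam x z₀
  obtain ⟨v, hv⟩ : ∃ v : Euc n → ℝ, ∀ x, Tendsto (fun lam => uLam g lam x) (𝓝[>] 0) (𝓝 (v x)) :=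
    ⟨_, fun x => (antitoneOn_uLam hg hgabs h0 x).tendsto_nhdsGT (hbdd x)⟩
  have hvlip : ∀ x y, v x ≤ v y + L * dist x y := fun x y =>
    le_of_tendsto_of_tendsto (hv x) ((hv y).add_const _)
      (eventually_mem_nhdsWithin.mono fun lam hlam => hlip lam hlam x y)
  refine ⟨v, ?_, fun x => ⟨?_, ?_⟩, fun x y => ?_, fun C1 C2 hC1 hC2 x h => ?_⟩
  · rw [Metric.tendstoLocallyUniformly_iff]
    intro ε hε x
    have hδ : 0 < ε / (4 * (L + 1)) := by positivity
    refine ⟨ball x (ε / (4 * (L + 1))), ball_mem_nhds x hδ, ?_⟩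
    filter_upwards [eventually_mem_nhdsWithin,
      (Metric.tendsto_nhds.1 (hv x)) (ε / 2) (by positivity)] with lam hlam hd y hy
    rw [mem_ball] at hy
    have hLd : L * dist y x < ε / 4 := by
      have h1 : (L + 1) * (ε / (4 * (L + 1))) = ε / 4 := by field_simp
      nlinarith [dist_nonneg (x := y) (y := x)]
    have hLd' : L * dist x y < ε / 4 := by rwa [dist_comm]
    have e := uLam_shift hcont habs hlam y flo
    rw [← e, Real.dist_eq, abs_lt]
    rw [Real.dist_eq, abs_lt] at hd
    have a1 := hlip lam hlam x y
    have a2 := hlip lam hlam y x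
    have a3 := hvlip x y
    have a4 := hvlip y x
    change -ε < v y - uLam g lam y ∧ v y - uLam g lam y < ε
    constructor <;> linarith [hd.1, hd.2]
  · exact ge_of_tendsto' (hv x) fun lam => uLam_nonneg h0 x
  · obtain ⟨z, hz, hzd⟩ := (isClosed_eq hcont continuous_const).exists_infDist_eq_dist
      (⟨z₀, hz₀⟩ : {z | f z = flo}.Nonempty) x
    rw [hzd]
    refine le_of_tendsto (hv x) (eventually_mem_nhdsWithin.mono fun lam hlam => ?_)
    simpa [hzero lam hlam z hz] using hlip lam hlam x z
  · have h1 := hvlip x y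
    have h2 := hvlip y x
    rw [dist_comm] at h2
    rw [abs_le]
    constructor <;> linarith
  · rcases eq_or_ne h 0 with rfl | hh
    · simp; linarith
    have hpos : 0 < ‖h‖ := norm_pos_iff.2 hh
    have hC1' : 0 ≤ C1 := by
      have h1 := (abs_nonneg _).trans (hC1 h 0)
      rw [dist_zero_right] at h1
      exact nonneg_of_mul_nonneg_left h1 hpos
    have hC2' : 0 ≤ C2 := by
      have h1 : 0 ≤ C2 * ‖h‖ ^ 2 := by
        linarith [hC2 z₀ h, hlo (z₀ + h), hlo (z₀ - h)]
      exact nonneg_of_mul_nonneg_left h1 (by positivity)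
    refine le_of_tendsto (((hv (x + h)).add (hv (x - h))).sub ((hv x).const_mul 2))
      (eventually_mem_nhdsWithin.mono fun lam hlam => ?_)
    refine uLam_semiconcave hg hgabs hlam (Real.sqrt_pos.2 (by positivity)) (C := C2) ?_ ?_ x h
    · rw [Real.sq_sqrt (by positivity)]
      linarith
    · intro y k
      have := hC2 y k
      simp only [hgdef]
      linarith
end

section
/- Assume (A). Then the functions x ↦ u(x,t) − f̲ · t converge locally uniformly on ℝⁿ as t → +∞, and the limit coincides with the function v obtained as the locally uniform limit of u_λ(·) − f̲/λ as λ → 0⁺; i.e. lim_{t→+∞} (u(x,t) − f̲ t) = lim_{λ→0⁺} (u_λ(x) − f̲/λ) for every x ∈ ℝⁿ, both limits existing. -/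
open MeasureTheory Filter Metric Set Topology

section ControlProblem

variable {n : ℕ}

/-- The trajectory of a measurable control is measurable in time. -/
lemma measurable_traj {α : ℝ → Euc n} (hα : Measurable α) (x : Euc n) :
    Measurable (traj x α) := by
  have hset : MeasurableSet {p : ℝ × ℝ | p.2 ∈ Ioc 0 p.1} :=
    (measurableSet_lt measurable_const measurable_snd).inter
      (measurableSet_le measurable_snd measurable_fst)
  have hunc : Measurable (fun p : ℝ × ℝ => {p : ℝ × ℝ | p.2 ∈ Ioc 0 p.1}.indicator
      (fun p => α p.2) p) := (hα.comp measurable_snd).indicator hset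
  have h := (hunc.stronglyMeasurable.integral_prod_right' (ν := volume)).measurable
  have heq : traj x α = fun t => x + ∫ s, {p : ℝ × ℝ | p.2 ∈ Ioc 0 p.1}.indicator
      (fun p => α p.2) (t, s) := by
    funext t
    rw [traj, ← integral_indicator measurableSet_Ioc]
    rfl
  rw [heq]
  exact measurable_const.add h

lemma measurable_fCost {f : Euc n → ℝ} (hf : Continuous f) {α : ℝ → Euc n}
    (hα : Measurable α) (x : Euc n) : Measurable (fCost f x α) := by
  have := hf.measurable.comp (measurable_traj hα x)
  exact ((hα.norm.pow_const 2).const_mul _).add this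

lemma dCost_eq (f : Euc n → ℝ) (lam : ℝ) (x : Euc n) (α : ℝ → Euc n) (t : ℝ) :
    dCost f lam x α t = fCost f x α t * Real.exp (-(lam * t)) := rfl

lemma measurable_dCost {f : Euc n → ℝ} (hf : Continuous f) (lam : ℝ) {α : ℝ → Euc n}
    (hα : Measurable α) (x : Euc n) : Measurable (dCost f lam x α) := by
  have := measurable_fCost hf hα x
  change Measurable fun t => fCost f x α t * Real.exp (-(lam * t))
  fun_prop

lemma fCost_nonneg {f : Euc n → ℝ} (h0 : ∀ x, 0 ≤ f x) (x : Euc n) (α : ℝ → Euc n) (s : ℝ) :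
    0 ≤ fCost f x α s :=
  add_nonneg (by positivity) (h0 _)

lemma norm_le_half_add_fCost {f : Euc n → ℝ} (h0 : ∀ x, 0 ≤ f x) (x : Euc n)
    (α : ℝ → Euc n) (s : ℝ) : ‖α s‖ ≤ 1 / 2 + fCost f x α s := by
  have := h0 (traj x α s)
  unfold fCost
  nlinarith [sq_nonneg (‖α s‖ - 1)]

/-- A control of finite cost is integrable. -/
lemma integrableOn_control {f : Euc n → ℝ} (h0 : ∀ x, 0 ≤ f x) {x : Euc n} {α : ℝ → Euc n}
    (hα : Measurable α) {t : ℝ} (hi : IntegrableOn (fCost f x α) (Ioc 0 t)) :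
    IntegrableOn α (Ioc 0 t) := by
  have hc : IntegrableOn (fun _ : ℝ => (1 / 2 : ℝ)) (Ioc 0 t) := by
    simp
  refine Integrable.mono' (hc.add hi) hα.aestronglyMeasurable (ae_of_all _ fun s => ?_)
  exact norm_le_half_add_fCost h0 x α s

/-- Displacement is bounded by elapsed time and cost. -/
lemma norm_traj_sub_le {f : Euc n → ℝ} (h0 : ∀ x, 0 ≤ f x) {x : Euc n} {α : ℝ → Euc n}
    {t : ℝ} (ht : 0 ≤ t) (hi : IntegrableOn (fCost f x α) (Ioc 0 t)) :
    ‖traj x α t - x‖ ≤ t / 2 + ∫ s in Ioc 0 t, fCost f x α s := by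
  have hc : IntegrableOn (fun _ : ℝ => (1 / 2 : ℝ)) (Ioc 0 t) := by
    simp
  have h : ‖∫ s in Ioc 0 t, α s‖ ≤ ∫ s in Ioc 0 t, (1 / 2 + fCost f x α s) :=
    norm_integral_le_of_norm_le (hc.add hi)
      (ae_of_all _ fun s => norm_le_half_add_fCost h0 x α s)
  rw [integral_add hc hi] at h
  have h2 : ∫ _ in Ioc (0 : ℝ) t, (1 / 2 : ℝ) = t / 2 := by
    simp [ht]; ring
  rw [h2] at h
  simpa only [traj, add_sub_cancel_left] using h

lemma uT_le {f : Euc n → ℝ} (h0 : ∀ x, 0 ≤ f x) {x : Euc n} {α : ℝ → Euc n}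
    (hα : Measurable α) {t : ℝ} (hi : IntegrableOn (fCost f x α) (Ioc 0 t)) :
    uT f x t ≤ ∫ s in Ioc 0 t, fCost f x α s := by
  refine csInf_le ⟨0, ?_⟩ ⟨α, hα, hi, rfl⟩
  rintro c ⟨β, -, -, rfl⟩
  exact integral_nonneg fun s => fCost_nonneg h0 x β s

lemma traj_zero (x : Euc n) (t : ℝ) : traj x (fun _ => (0 : Euc n)) t = x := by
  simp [traj]

lemma fCost_zero (f : Euc n → ℝ) (x : Euc n) : fCost f x (fun _ => 0) = fun _ => f x := by
  funext s
  simp [fCost, traj_zero]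

lemma le_uT {f : Euc n → ℝ} {x : Euc n} {t c : ℝ}
    (h : ∀ α : ℝ → Euc n, Measurable α → IntegrableOn (fCost f x α) (Ioc 0 t) →
      c ≤ ∫ s in Ioc 0 t, fCost f x α s) : c ≤ uT f x t := by
  refine le_csInf ⟨_, fun _ => 0, measurable_const, ?_, rfl⟩ ?_
  · rw [fCost_zero]; simp
  · rintro c ⟨β, hβ, hi, rfl⟩
    exact h β hβ hi

lemma exists_control_lt {f : Euc n → ℝ} {x : Euc n} {t c : ℝ} (hc : uT f x t < c) :
    ∃ α : ℝ → Euc n, Measurable α ∧ IntegrableOn (fCost f x α) (Ioc 0 t) ∧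
      ∫ s in Ioc 0 t, fCost f x α s < c := by
  by_contra! h
  exact hc.not_ge (le_uT h)

lemma uT_mono {f : Euc n → ℝ} (h0 : ∀ x, 0 ≤ f x) (x : Euc n) : Monotone (uT f x) := by
  intro s t hst
  refine le_uT fun α hα hi => ?_
  have hsub : Ioc (0 : ℝ) s ⊆ Ioc 0 t := Ioc_subset_Ioc_right hst
  refine (uT_le h0 hα (hi.mono_set hsub)).trans ?_
  exact setIntegral_mono_set hi (ae_of_all _ fun s => fCost_nonneg h0 x α s)
    hsub.eventuallyLE

/-- Follow the control `a` up to time `S`, then restart with the control `b`. -/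
noncomputable def concatControl (S : ℝ) (a b : ℝ → Euc n) (s : ℝ) : Euc n :=
  if s ≤ S then a s else b (s - S)

lemma measurable_concatControl (S : ℝ) {a b : ℝ → Euc n} (ha : Measurable a)
    (hb : Measurable b) : Measurable (concatControl S a b) :=
  Measurable.ite measurableSet_Iic ha (hb.comp (measurable_id.sub_const S))

lemma traj_concatControl_of_le {S s : ℝ} (a b : ℝ → Euc n) (x : Euc n) (hs : s ≤ S) :
    traj x (concatControl S a b) s = traj x a s := by
  unfold traj
  congr 1
  refine setIntegral_congr_fun measurableSet_Ioc fun r hr => ?_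
  exact if_pos (hr.2.trans hs)

lemma measurePreserving_sub_const (S : ℝ) : MeasurePreserving (fun s : ℝ => s - S) :=
  measurePreserving_sub_right volume S

lemma setIntegral_shift {E : Type*} [NormedAddCommGroup E] [NormedSpace ℝ E] (S : ℝ)
    (h : ℝ → E) (A : Set ℝ) :
    ∫ s in (fun s => s - S) ⁻¹' A, h (s - S) = ∫ s in A, h s :=
  (measurePreserving_sub_const S).setIntegral_preimage_emb
    (MeasurableEquiv.subRight S).measurableEmbedding h A

lemma integrableOn_shift {E : Type*} [NormedAddCommGroup E] (S : ℝ)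
    (h : ℝ → E) (A : Set ℝ) :
    IntegrableOn (fun s => h (s - S)) ((fun s => s - S) ⁻¹' A) ↔ IntegrableOn h A :=
  (measurePreserving_sub_const S).integrableOn_comp_preimage
    (MeasurableEquiv.subRight S).measurableEmbedding

lemma traj_concatControl_of_gt {S s : ℝ} {a b : ℝ → Euc n} (x : Euc n) (hS : 0 ≤ S)
    (hs : S < s) (ha : IntegrableOn a (Ioc 0 S)) (hb : IntegrableOn b (Ioc 0 (s - S))) :
    traj x (concatControl S a b) s = traj (traj x a S) b (s - S) := by
  have hpre : (fun r => r - S) ⁻¹' Ioc 0 (s - S) = Ioc S s := by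
    simp
  have e1 : EqOn (concatControl S a b) a (Ioc 0 S) := fun r hr => if_pos hr.2
  have e2 : EqOn (concatControl S a b) (fun r => b (r - S)) (Ioc S s) :=
    fun r hr => if_neg hr.1.not_ge
  have i1 := ha.congr_fun e1.symm measurableSet_Ioc
  have i2 : IntegrableOn (concatControl S a b) (Ioc S s) := by
    refine IntegrableOn.congr_fun ?_ e2.symm measurableSet_Ioc
    rw [← hpre]
    exact (integrableOn_shift S b _).2 hb
  have hu : Ioc 0 s = Ioc 0 S ∪ Ioc S s := (Ioc_union_Ioc_eq_Ioc hS hs.le).symm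
  unfold traj
  rw [hu, setIntegral_union (Ioc_disjoint_Ioc_of_le le_rfl) measurableSet_Ioc i1 i2,
    setIntegral_congr_fun measurableSet_Ioc e1, setIntegral_congr_fun measurableSet_Ioc e2,
    ← setIntegral_shift S b, hpre, add_assoc]

lemma fCost_concatControl_of_le (f : Euc n → ℝ) {S s : ℝ} (a b : ℝ → Euc n) (x : Euc n)
    (hs : s ≤ S) : fCost f x (concatControl S a b) s = fCost f x a s := by
  rw [fCost, fCost, traj_concatControl_of_le a b x hs, concatControl, if_pos hs]

lemma fCost_concatControl_of_gt (f : Euc n → ℝ) {S s : ℝ} {a b : ℝ → Euc n} (x : Euc n)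
    (hS : 0 ≤ S) (hs : S < s) (ha : IntegrableOn a (Ioc 0 S))
    (hb : IntegrableOn b (Ioc 0 (s - S))) :
    fCost f x (concatControl S a b) s = fCost f (traj x a S) b (s - S) := by
  rw [fCost, fCost, traj_concatControl_of_gt x hS hs ha hb, concatControl, if_neg hs.not_ge]

/-- Move from `y` to `z` along a segment at unit speed, then rest. -/
noncomputable def reachControl (y z : Euc n) (s : ℝ) : Euc n :=
  if s ≤ ‖z - y‖ then ‖z - y‖⁻¹ • (z - y) else 0

lemma measurable_reachControl (y z : Euc n) : Measurable (reachControl y z) :=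
  Measurable.ite measurableSet_Iic measurable_const measurable_const

lemma norm_reachControl_le (y z : Euc n) (s : ℝ) : ‖reachControl y z s‖ ≤ 1 := by
  unfold reachControl
  split_ifs
  · rw [norm_smul, norm_inv, norm_norm]
    exact inv_mul_le_one
  · simp

lemma integrableOn_reachControl (y z : Euc n) (t : ℝ) :
    IntegrableOn (reachControl y z) (Ioc 0 t) := by
  have hc : IntegrableOn (fun _ : ℝ => (1 : ℝ)) (Ioc 0 t) := by
    simp
  exact Integrable.mono' hc (measurable_reachControl y z).aestronglyMeasurable
    (ae_of_all _ fun s => norm_reachControl_le y z s)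

lemma traj_reachControl_of_ge {y z : Euc n} {t : ℝ} (ht : ‖z - y‖ ≤ t) :
    traj y (reachControl y z) t = z := by
  have e : (Ioc 0 ‖z - y‖).indicator (reachControl y z)
      = (Ioc 0 ‖z - y‖).indicator fun _ => ‖z - y‖⁻¹ • (z - y) := by
    refine indicator_congr fun s hs => if_pos hs.2
  have h : ∫ s in Ioc 0 t, reachControl y z s = z - y := by
    have hrest : ∀ s ∈ Ioc 0 t \ Ioc 0 ‖z - y‖, reachControl y z s = 0 :=
      fun s hs => if_neg fun h => hs.2 ⟨hs.1.1, h⟩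
    rw [setIntegral_eq_of_subset_of_forall_sdiff_eq_zero measurableSet_Ioc
      (Ioc_subset_Ioc_right ht) hrest, ← integral_indicator measurableSet_Ioc, e, integral_indicator measurableSet_Ioc,
      setIntegral_const]
    rcases eq_or_ne (z - y) 0 with h | h
    · simp [h]
    · simp [smul_smul, h]
  rw [traj, h, add_sub_cancel]

lemma fCost_reachControl_le {f : Euc n → ℝ} {M : ℝ} (hM : ∀ x, f x ≤ M) (y z : Euc n)
    (s : ℝ) : fCost f y (reachControl y z) s ≤ 1 / 2 + M := by
  have h1 := norm_reachControl_le y z s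
  have h2 := hM (traj y (reachControl y z) s)
  unfold fCost
  nlinarith [norm_nonneg (reachControl y z s)]

lemma integrableOn_fCost_reachControl {f : Euc n → ℝ} (hf : Continuous f)
    (h0 : ∀ x, 0 ≤ f x) {M : ℝ} (hM : ∀ x, f x ≤ M) (y z : Euc n) (t : ℝ) :
    IntegrableOn (fCost f y (reachControl y z)) (Ioc 0 t) := by
  have hc : IntegrableOn (fun _ : ℝ => 1 / 2 + M) (Ioc 0 t) := by
    simp
  refine Integrable.mono' hc
    (measurable_fCost hf (measurable_reachControl y z) y).aestronglyMeasurable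
    (ae_of_all _ fun s => ?_)
  rw [Real.norm_of_nonneg (fCost_nonneg h0 _ _ _)]
  exact fCost_reachControl_le hM y z s

/-- The cost of moving from `y` to `z` is at most proportional to the distance. -/
lemma integral_fCost_reachControl_le {f : Euc n → ℝ} (hf : Continuous f)
    (h0 : ∀ x, 0 ≤ f x) {M : ℝ} (hM : ∀ x, f x ≤ M) (y z : Euc n) :
    ∫ s in Ioc 0 ‖z - y‖, fCost f y (reachControl y z) s ≤ (1 / 2 + M) * ‖z - y‖ := by
  have hc : IntegrableOn (fun _ : ℝ => 1 / 2 + M) (Ioc 0 ‖z - y‖) := by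
    simp
  refine (setIntegral_mono (integrableOn_fCost_reachControl hf h0 hM y z _) hc
    fun s => fCost_reachControl_le hM y z s).trans_eq ?_
  simp [mul_comm]

/-- The finite-horizon value functions are equi-Lipschitz in space. -/
lemma uT_le_add {f : Euc n → ℝ} (hf : Continuous f) (h0 : ∀ x, 0 ≤ f x) {M : ℝ}
    (hM : ∀ x, f x ≤ M) (x y : Euc n) {t : ℝ} (ht : 0 ≤ t) :
    uT f x t ≤ uT f y t + (1 / 2 + M) * ‖y - x‖ := by
  rw [← sub_le_iff_le_add]
  refine le_uT fun α hα hi => ?_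
  rw [sub_le_iff_le_add]
  set D := ‖y - x‖
  have hD0 : 0 ≤ D := norm_nonneg _
  set γ := concatControl D (reachControl x y) α
  have hγ : Measurable γ := measurable_concatControl D (measurable_reachControl x y) hα
  have ha := integrableOn_reachControl x y D
  have hb := integrableOn_control h0 hα hi
  have hpre : (fun r => r - D) ⁻¹' Ioc 0 t = Ioc D (t + D) := by simp
  have e1 : EqOn (fCost f x γ) (fCost f x (reachControl x y)) (Ioc 0 D) :=
    fun r hr => fCost_concatControl_of_le f _ _ x hr.2
  have e2 : EqOn (fCost f x γ) (fun r => fCost f y α (r - D)) (Ioc D (t + D)) := by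
    intro r hr
    have := fCost_concatControl_of_gt f x hD0 hr.1 ha
      (hb.mono_set (Ioc_subset_Ioc_right (by linarith [hr.2])))
    rwa [traj_reachControl_of_ge le_rfl] at this
  have i1 := (integrableOn_fCost_reachControl hf h0 hM x y D).congr_fun e1.symm
    measurableSet_Ioc
  have i2 : IntegrableOn (fCost f x γ) (Ioc D (t + D)) := by
    refine IntegrableOn.congr_fun ?_ e2.symm measurableSet_Ioc
    rw [← hpre]
    exact (integrableOn_shift D (fCost f y α) _).2 hi
  have hu : Ioc 0 (t + D) = Ioc 0 D ∪ Ioc D (t + D) :=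
    (Ioc_union_Ioc_eq_Ioc hD0 (by linarith)).symm
  have hcost : ∫ s in Ioc 0 (t + D), fCost f x γ s
      = (∫ s in Ioc 0 D, fCost f x (reachControl x y) s) + ∫ s in Ioc 0 t, fCost f y α s := by
    rw [hu, setIntegral_union (Ioc_disjoint_Ioc_of_le le_rfl) measurableSet_Ioc i1 i2,
      setIntegral_congr_fun measurableSet_Ioc e1, setIntegral_congr_fun measurableSet_Ioc e2,
      ← setIntegral_shift D (fCost f y α), hpre]
  calc uT f x t ≤ uT f x (t + D) := uT_mono h0 x (by linarith)
    _ ≤ ∫ s in Ioc 0 (t + D), fCost f x γ s := uT_le h0 hγ (hu ▸ i1.union i2)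
    _ ≤ _ := by
      rw [hcost]
      linarith [integral_fCost_reachControl_le hf h0 hM x y]

lemma uT_le_dist {f : Euc n → ℝ} (hf : Continuous f) (h0 : ∀ x, 0 ≤ f x) {M : ℝ}
    (hM : ∀ x, f x ≤ M) {z : Euc n} (hz : f z = 0) (x : Euc n) (t : ℝ) :
    uT f x t ≤ (1 / 2 + M) * ‖z - x‖ := by
  have h1 := uT_le_add hf h0 hM x z (le_max_left 0 t)
  have h2 : uT f z (max 0 t) ≤ 0 := by
    have := uT_le (f := f) (x := z) (t := max 0 t) h0 (α := fun _ => 0) measurable_const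
      (by rw [fCost_zero]; simp)
    simpa [fCost_zero, hz] using this
  linarith [uT_mono h0 x (le_max_right 0 t)]

lemma uLam_le_s8 {f : Euc n → ℝ} (h0 : ∀ x, 0 ≤ f x) {x : Euc n} {α : ℝ → Euc n}
    (hα : Measurable α) {lam : ℝ} (hi : IntegrableOn (dCost f lam x α) (Ioi 0)) :
    uLam f lam x ≤ ∫ s in Ioi 0, dCost f lam x α s := by
  refine csInf_le ⟨0, ?_⟩ ⟨α, hα, hi, rfl⟩
  rintro c ⟨β, -, -, rfl⟩
  exact integral_nonneg fun s => mul_nonneg (fCost_nonneg h0 x β s) (Real.exp_pos _).le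

lemma le_uLam_s8 {f : Euc n → ℝ} {x : Euc n} {lam c : ℝ} (hlam : 0 < lam)
    (h : ∀ α : ℝ → Euc n, Measurable α → IntegrableOn (dCost f lam x α) (Ioi 0) →
      c ≤ ∫ s in Ioi 0, dCost f lam x α s) : c ≤ uLam f lam x := by
  refine le_csInf ⟨_, fun _ => 0, measurable_const, ?_, rfl⟩ ?_
  · have : dCost f lam x (fun _ => 0) = fun t => f x * Real.exp (-lam * t) := by
      funext t
      simp [dCost_eq, fCost_zero]
    rw [this]
    exact (exp_neg_integrableOn_Ioi 0 hlam).const_mul _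
  · rintro c ⟨β, hβ, hi, rfl⟩
    exact h β hβ hi

/-- The discounted value dominates the discounted finite-horizon value. -/
lemma exp_mul_uT_le_uLam {f : Euc n → ℝ} (hf : Continuous f) (h0 : ∀ x, 0 ≤ f x)
    (x : Euc n) {lam : ℝ} (hlam : 0 < lam) (T : ℝ) :
    Real.exp (-(lam * T)) * uT f x T ≤ uLam f lam x := by
  refine le_uLam_s8 hlam fun α hα hi => ?_
  have hd0 : ∀ s, 0 ≤ dCost f lam x α s := fun s =>
    mul_nonneg (fCost_nonneg h0 x α s) (Real.exp_pos _).le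
  have hiT : IntegrableOn (dCost f lam x α) (Ioc 0 T) := hi.mono_set Ioc_subset_Ioi_self
  have hle : ∀ s ∈ Ioc 0 T, Real.exp (-(lam * T)) * fCost f x α s ≤ dCost f lam x α s := by
    intro s hs
    rw [dCost_eq, mul_comm]
    refine mul_le_mul_of_nonneg_left ?_ (fCost_nonneg h0 x α s)
    exact Real.exp_le_exp.2 (neg_le_neg (mul_le_mul_of_nonneg_left hs.2 hlam.le))
  have hf1 : IntegrableOn (fun s => Real.exp (-(lam * T)) * fCost f x α s) (Ioc 0 T) := by
    refine Integrable.mono' hiT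
      ((measurable_fCost hf hα x).const_mul _).aestronglyMeasurable ?_
    refine (ae_restrict_iff' measurableSet_Ioc).2 (ae_of_all _ fun s hs => ?_)
    rw [Real.norm_of_nonneg (mul_nonneg (Real.exp_pos _).le (fCost_nonneg h0 x α s))]
    exact hle s hs
  have hf2 : IntegrableOn (fCost f x α) (Ioc 0 T) :=
    (integrable_const_mul_iff (Real.exp_pos _).ne'.isUnit _).1 hf1
  calc Real.exp (-(lam * T)) * uT f x T
      ≤ Real.exp (-(lam * T)) * ∫ s in Ioc 0 T, fCost f x α s :=
        mul_le_mul_of_nonneg_left (uT_le h0 hα hf2) (Real.exp_pos _).le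
    _ = ∫ s in Ioc 0 T, Real.exp (-(lam * T)) * fCost f x α s := (integral_const_mul _ _).symm
    _ ≤ ∫ s in Ioc 0 T, dCost f lam x α s := setIntegral_mono_on hf1 hiT measurableSet_Ioc hle
    _ ≤ _ := setIntegral_mono_set hi (ae_of_all _ hd0) Ioc_subset_Ioi_self.eventuallyLE

/-- Following a control up to time `T` and then moving to a zero `z` of `f` bounds the
discounted value. -/
lemma uLam_le_cost_add {f : Euc n → ℝ} (hf : Continuous f) (h0 : ∀ x, 0 ≤ f x) {M : ℝ}
    (hM : ∀ x, f x ≤ M) {z : Euc n} (hz : f z = 0) (x : Euc n) {lam T : ℝ} (hlam : 0 < lam)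
    (hT : 0 ≤ T) {α : ℝ → Euc n} (hα : Measurable α)
    (hi : IntegrableOn (fCost f x α) (Ioc 0 T)) :
    uLam f lam x ≤ (∫ s in Ioc 0 T, fCost f x α s)
      + Real.exp (-(lam * T)) * ((1 / 2 + M) * ‖z - traj x α T‖) := by
  set y := traj x α T
  set D := ‖z - y‖
  have hD0 : 0 ≤ D := norm_nonneg _
  set γ := concatControl T α (reachControl y z) with hγdef
  have hγ : Measurable γ := measurable_concatControl T hα (measurable_reachControl y z)
  have ha := integrableOn_control h0 hα hi
  have hd0 : ∀ s, 0 ≤ dCost f lam x γ s := fun s =>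
    mul_nonneg (fCost_nonneg h0 x γ s) (Real.exp_pos _).le
  have hpre : (fun r => r - T) ⁻¹' Ioc 0 D = Ioc T (D + T) := by simp
  have hle1 : ∀ s ∈ Ioc 0 T, dCost f lam x γ s ≤ fCost f x α s := by
    intro s hs
    rw [dCost_eq, hγdef, fCost_concatControl_of_le f _ _ x hs.2]
    refine mul_le_of_le_one_right (fCost_nonneg h0 x α s) (Real.exp_le_one_iff.2 ?_)
    have := mul_pos hlam hs.1
    linarith
  have hcost2 : ∀ s, T < s → fCost f x γ s = fCost f y (reachControl y z) (s - T) :=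
    fun s hs => fCost_concatControl_of_gt f x hT hs ha (integrableOn_reachControl y z _)
  have hle2 : ∀ s ∈ Ioc T (D + T), dCost f lam x γ s
      ≤ Real.exp (-(lam * T)) * fCost f y (reachControl y z) (s - T) := by
    intro s hs
    rw [dCost_eq, hcost2 s hs.1, mul_comm]
    refine mul_le_mul_of_nonneg_right ?_ (fCost_nonneg h0 y _ _)
    exact Real.exp_le_exp.2 (neg_le_neg (mul_le_mul_of_nonneg_left hs.1.le hlam.le))
  have hzero : ∀ s ∈ Ioi 0 \ Ioc 0 (D + T), dCost f lam x γ s = 0 := by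
    intro s hs
    have hs' : D + T < s := by
      by_contra! h
      exact hs.2 ⟨hs.1, h⟩
    have h1 : D < s - T := by linarith
    rw [dCost_eq, hcost2 s (by linarith), fCost, traj_reachControl_of_ge h1.le, hz,
      reachControl, if_neg h1.not_ge]
    simp
  have hmeas := measurable_dCost hf lam hγ x
  have i1 : IntegrableOn (dCost f lam x γ) (Ioc 0 T) := by
    refine Integrable.mono' hi hmeas.aestronglyMeasurable
      ((ae_restrict_iff' measurableSet_Ioc).2 (ae_of_all _ fun s hs => ?_))
    rw [Real.norm_of_nonneg (hd0 s)]
    exact hle1 s hs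
  have j2 : IntegrableOn (fun s => Real.exp (-(lam * T))
      * fCost f y (reachControl y z) (s - T)) (Ioc T (D + T)) := by
    rw [← hpre]
    exact ((integrableOn_shift T (fCost f y (reachControl y z)) _).2
      (integrableOn_fCost_reachControl hf h0 hM y z D)).const_mul _
  have i2 : IntegrableOn (dCost f lam x γ) (Ioc T (D + T)) := by
    refine Integrable.mono' j2 hmeas.aestronglyMeasurable
      ((ae_restrict_iff' measurableSet_Ioc).2 (ae_of_all _ fun s hs => ?_))
    rw [Real.norm_of_nonneg (hd0 s)]
    exact hle2 s hs
  have hu : Ioc 0 (D + T) = Ioc 0 T ∪ Ioc T (D + T) :=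
    (Ioc_union_Ioc_eq_Ioc hT (by linarith)).symm
  have i3 : IntegrableOn (dCost f lam x γ) (Ioi 0) :=
    (hu ▸ i1.union i2 : IntegrableOn (dCost f lam x γ) (Ioc 0 (D + T))).of_forall_sdiff_eq_zero
      measurableSet_Ioi hzero
  calc uLam f lam x ≤ ∫ s in Ioi 0, dCost f lam x γ s := uLam_le_s8 h0 hγ i3
    _ = ∫ s in Ioc 0 (D + T), dCost f lam x γ s :=
      setIntegral_eq_of_subset_of_forall_sdiff_eq_zero measurableSet_Ioi
        Ioc_subset_Ioi_self hzero
    _ = (∫ s in Ioc 0 T, dCost f lam x γ s) + ∫ s in Ioc T (D + T), dCost f lam x γ s := by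
      rw [hu, setIntegral_union (Ioc_disjoint_Ioc_of_le le_rfl) measurableSet_Ioc i1 i2]
    _ ≤ (∫ s in Ioc 0 T, fCost f x α s) + ∫ s in Ioc T (D + T), Real.exp (-(lam * T))
          * fCost f y (reachControl y z) (s - T) :=
      add_le_add (setIntegral_mono_on i1 hi measurableSet_Ioc hle1)
        (setIntegral_mono_on i2 j2 measurableSet_Ioc hle2)
    _ ≤ _ := by
      rw [integral_const_mul, ← hpre, setIntegral_shift T (fCost f y (reachControl y z))]
      gcongr
      exact integral_fCost_reachControl_le hf h0 hM y z

/-- Discounting cannot increase the limit of the finite-horizon values. -/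
lemma uLam_le_of_forall_uT_le {f : Euc n → ℝ} (hf : Continuous f) (h0 : ∀ x, 0 ≤ f x) {M : ℝ}
    (hM : ∀ x, f x ≤ M) {z : Euc n} (hz : f z = 0) (x : Euc n) {lam c : ℝ} (hlam : 0 < lam)
    (hc : ∀ t, uT f x t ≤ c) : uLam f lam x ≤ c := by
  refine le_of_forall_pos_le_add fun ε hε => ?_
  set B := ‖z - x‖ + (c + ε)
  have hM0 : 0 ≤ M := (h0 z).trans (hM z)
  have hbound : ∀ T, 0 ≤ T → uLam f lam x
      ≤ c + ε + Real.exp (-(lam * T)) * ((1 / 2 + M) * (B + T / 2)) := by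
    intro T hT
    obtain ⟨α, hα, hi, hlt⟩ := exists_control_lt ((hc T).trans_lt (lt_add_of_pos_right c hε))
    have h1 := uLam_le_cost_add hf h0 hM hz x hlam hT hα hi
    have h2 := norm_traj_sub_le h0 hT hi
    have h3 : ‖z - traj x α T‖ ≤ B + T / 2 := by
      have := norm_sub_le (z - x) (traj x α T - x)
      rw [sub_sub_sub_cancel_right] at this
      linarith
    refine h1.trans (add_le_add hlt.le ?_)
    gcongr
  have hlim : Tendsto (fun T : ℝ => c + ε + Real.exp (-(lam * T)) * ((1 / 2 + M) * (B + T / 2)))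
      atTop (𝓝 (c + ε)) := by
    have t0 : Tendsto (fun T : ℝ => lam * T) atTop atTop := tendsto_id.const_mul_atTop hlam
    have t1 : Tendsto (fun T : ℝ => Real.exp (-(lam * T))) atTop (𝓝 0) :=
      Real.tendsto_exp_neg_atTop_nhds_zero.comp t0
    have t2 : Tendsto (fun T : ℝ => (lam * T) ^ 1 * Real.exp (-(lam * T))) atTop (𝓝 0) :=
      (Real.tendsto_pow_mul_exp_neg_atTop_nhds_zero 1).comp t0
    have t3 := ((t1.const_mul ((1 / 2 + M) * B)).add
      (t2.const_mul ((1 / 2 + M) / (2 * lam)))).const_add (c + ε)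
    simp only [mul_zero, add_zero] at t3
    refine t3.congr fun T => ?_
    field_simp
  exact ge_of_tendsto hlim ((eventually_ge_atTop 0).mono hbound)

lemma fCost_sub_const (f : Euc n → ℝ) (c : ℝ) (x : Euc n) (α : ℝ → Euc n) (s : ℝ) :
    fCost (fun y => f y - c) x α s = fCost f x α s - c := by
  unfold fCost
  ring

lemma uT_sub_const {f : Euc n → ℝ} {c : ℝ} (hc : ∀ x, c ≤ f x) (x : Euc n) {t : ℝ}
    (ht : 0 ≤ t) : uT (fun y => f y - c) x t = uT f x t - c * t := by
  have h0 : ∀ y, 0 ≤ f y - c := fun y => sub_nonneg.2 (hc y)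
  have hconst : IntegrableOn (fun _ : ℝ => c) (Ioc 0 t) := by
    simp
  have hiff : ∀ α : ℝ → Euc n, IntegrableOn (fCost (fun y => f y - c) x α) (Ioc 0 t) ↔
      IntegrableOn (fCost f x α) (Ioc 0 t) := by
    intro α
    rw [funext (fCost_sub_const f c x α)]
    refine ⟨fun h => ?_, fun h => Integrable.sub h hconst⟩
    exact (Integrable.add h hconst).congr (ae_of_all _ fun s => sub_add_cancel _ _)
  have hint : ∀ α : ℝ → Euc n, IntegrableOn (fCost f x α) (Ioc 0 t) →
      ∫ s in Ioc 0 t, fCost (fun y => f y - c) x α s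
        = (∫ s in Ioc 0 t, fCost f x α s) - c * t := by
    intro α hi
    rw [funext (fCost_sub_const f c x α), integral_sub hi hconst]
    simp [ht, mul_comm]
  refine le_antisymm ?_ ?_
  · rw [le_sub_iff_add_le]
    refine le_uT fun α hα hi => ?_
    have := uT_le h0 hα ((hiff α).2 hi)
    rw [hint α hi] at this
    linarith
  · refine le_uT fun α hα hi => ?_
    rw [hint α ((hiff α).1 hi), sub_le_sub_iff_right]
    refine csInf_le ⟨c * t, ?_⟩ ⟨α, hα, (hiff α).1 hi, rfl⟩
    rintro _ ⟨β, -, hβ, rfl⟩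
    have : 0 ≤ ∫ s in Ioc 0 t, fCost (fun y => f y - c) x β s :=
      integral_nonneg fun s => fCost_nonneg h0 x β s
    rw [hint β hβ] at this
    linarith

lemma uLam_sub_const {f : Euc n → ℝ} {c : ℝ} (hc : ∀ x, c ≤ f x) (x : Euc n) {lam : ℝ}
    (hlam : 0 < lam) : uLam (fun y => f y - c) lam x = uLam f lam x - c / lam := by
  have h0 : ∀ y, 0 ≤ f y - c := fun y => sub_nonneg.2 (hc y)
  have hconst : IntegrableOn (fun s : ℝ => c * Real.exp (-lam * s)) (Ioi 0) :=
    (exp_neg_integrableOn_Ioi 0 hlam).const_mul c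
  have hval : ∫ s in Ioi (0 : ℝ), c * Real.exp (-lam * s) = c / lam := by
    rw [integral_const_mul, integral_exp_mul_Ioi (neg_lt_zero.2 hlam)]
    simp [div_eq_mul_inv]
  have hsub : ∀ α : ℝ → Euc n, dCost (fun y => f y - c) lam x α
      = fun s => dCost f lam x α s - c * Real.exp (-lam * s) := by
    intro α
    funext s
    rw [dCost_eq, dCost_eq, fCost_sub_const, sub_mul, neg_mul]
  have hiff : ∀ α : ℝ → Euc n, IntegrableOn (dCost (fun y => f y - c) lam x α) (Ioi 0) ↔
      IntegrableOn (dCost f lam x α) (Ioi 0) := by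
    intro α
    rw [hsub]
    refine ⟨fun h => ?_, fun h => Integrable.sub h hconst⟩
    exact (Integrable.add h hconst).congr (ae_of_all _ fun s => sub_add_cancel _ _)
  have hint : ∀ α : ℝ → Euc n, IntegrableOn (dCost f lam x α) (Ioi 0) →
      ∫ s in Ioi 0, dCost (fun y => f y - c) lam x α s
        = (∫ s in Ioi 0, dCost f lam x α s) - c / lam := by
    intro α hi
    rw [hsub, integral_sub hi hconst, hval]
  refine le_antisymm ?_ ?_
  · rw [le_sub_iff_add_le]
    refine le_uLam_s8 hlam fun α hα hi => ?_
    have := uLam_le_s8 h0 hα ((hiff α).2 hi)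
    rw [hint α hi] at this
    linarith
  · refine le_uLam_s8 hlam fun α hα hi => ?_
    rw [hint α ((hiff α).1 hi), sub_le_sub_iff_right]
    refine csInf_le ⟨c / lam, ?_⟩ ⟨α, hα, (hiff α).1 hi, rfl⟩
    rintro _ ⟨β, -, hβ, rfl⟩
    have : 0 ≤ ∫ s in Ioi 0, dCost (fun y => f y - c) lam x β s :=
      integral_nonneg fun s => mul_nonneg (fCost_nonneg h0 x β s) (Real.exp_pos _).le
    rw [hint β hβ] at this
    linarith

lemma tendstoLocallyUniformly_congr_eventually {ι X : Type*} [TopologicalSpace X]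
    {l : Filter ι} {F G : ι → X → ℝ} {v : X → ℝ} (hF : TendstoLocallyUniformly F v l)
    (h : ∀ᶠ i in l, F i = G i) : TendstoLocallyUniformly G v l := by
  intro u hu x
  obtain ⟨t, ht, hev⟩ := hF u hu x
  refine ⟨t, ht, ?_⟩
  filter_upwards [hev, h] with i h1 h2
  rwa [← h2]

/-- Pointwise limits of equi-Lipschitz families are locally uniform. -/
lemma tendstoLocallyUniformly_of_lipschitz {ι X : Type*} [PseudoMetricSpace X] {l : Filter ι}
    [l.NeBot] {F : ι → X → ℝ} {v : X → ℝ} {K : ℝ}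
    (hF : ∀ᶠ i in l, ∀ x y, F i x ≤ F i y + K * dist x y)
    (hv : ∀ x, Tendsto (fun i => F i x) l (𝓝 (v x))) : TendstoLocallyUniformly F v l := by
  have hvK : ∀ x y, v x ≤ v y + K * dist x y := fun x y =>
    le_of_tendsto_of_tendsto (hv x) ((hv y).add_const _) (hF.mono fun i h => h x y)
  rw [Metric.tendstoLocallyUniformly_iff]
  intro ε hε x
  have hball : ∀ᶠ y in 𝓝 x, K * dist x y < ε / 3 := by
    have : Tendsto (fun y => K * dist x y) (𝓝 x) (𝓝 (K * dist x x)) :=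
      ((continuous_const.dist continuous_id).const_mul K).tendsto x
    rw [dist_self, mul_zero] at this
    exact this.eventually_lt_const (by positivity)
  refine ⟨_, hball, ?_⟩
  filter_upwards [hF, Metric.tendsto_nhds.1 (hv x) (ε / 3) (by positivity)] with i h1 h2 y hy
  rw [Real.dist_eq, abs_lt] at *
  have hy' : K * dist x y < ε / 3 := hy
  have a1 := hvK x y
  have a2 := hvK y x
  have a3 := h1 x y
  have a4 := h1 y x
  rw [dist_comm y x] at a2 a4
  constructor <;> linarith [h2.1, h2.2]

/-- The normalized case of the convergence theorem: the running cost has minimum zero. -/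
lemma exists_tendstoLocallyUniformly_of_min_zero {f : Euc n → ℝ} (hf : Continuous f)
    (h0 : ∀ x, 0 ≤ f x) {M : ℝ} (hM : ∀ x, f x ≤ M) {z : Euc n} (hz : f z = 0) :
    ∃ v : Euc n → ℝ, TendstoLocallyUniformly (fun (t : ℝ) (x : Euc n) => uT f x t) v atTop ∧
      TendstoLocallyUniformly (fun (lam : ℝ) (x : Euc n) => uLam f lam x) v (𝓝[>] (0 : ℝ)) := by
  have hbdd : ∀ x, BddAbove (range (uT f x)) := fun x =>
    ⟨_, by rintro _ ⟨t, rfl⟩; exact uT_le_dist hf h0 hM hz x t⟩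
  set v : Euc n → ℝ := fun x => ⨆ t, uT f x t
  have hle : ∀ x t, uT f x t ≤ v x := fun x t => le_ciSup (hbdd x) t
  have hunif : TendstoLocallyUniformly (fun (t : ℝ) (x : Euc n) => uT f x t) v atTop := by
    refine tendstoLocallyUniformly_of_lipschitz (K := 1 / 2 + M) ?_
      fun x => tendsto_atTop_ciSup (uT_mono h0 x) (hbdd x)
    filter_upwards [eventually_ge_atTop 0] with t ht x y
    rw [dist_comm, dist_eq_norm]
    exact uT_le_add hf h0 hM x y ht
  refine ⟨v, hunif, ?_⟩
  have hM0 : 0 ≤ M := (h0 z).trans (hM z)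
  rw [Metric.tendstoLocallyUniformly_iff] at hunif ⊢
  intro ε hε x
  obtain ⟨U, hU, hev⟩ := hunif (ε / 2) (by positivity) x
  obtain ⟨T, hT, hT0⟩ := (hev.and (eventually_ge_atTop 0)).exists
  set R := (1 / 2 + M) * (‖z - x‖ + 1) with hR
  refine ⟨U ∩ Metric.ball x 1, inter_mem hU (Metric.ball_mem_nhds x one_pos), ?_⟩
  have hexp : ∀ᶠ lam : ℝ in 𝓝[>] 0, (1 - Real.exp (-(lam * T))) * R < ε / 2 := by
    have : Tendsto (fun lam : ℝ => (1 - Real.exp (-(lam * T))) * R) (𝓝 0)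
        (𝓝 ((1 - Real.exp (-(0 * T))) * R)) :=
      Continuous.tendsto (by fun_prop) 0
    simp only [zero_mul, neg_zero, Real.exp_zero, sub_self] at this
    exact (this.mono_left nhdsWithin_le_nhds).eventually_lt_const (by positivity)
  filter_upwards [hexp, self_mem_nhdsWithin] with lam h1 hlam y hy
  have hup := uLam_le_of_forall_uT_le hf h0 hM hz y hlam (hle y)
  have hlow := exp_mul_uT_le_uLam hf h0 y hlam T
  have hyT := hT y hy.1
  rw [Real.dist_eq, abs_lt] at hyT
  have hvR : uT f y T ≤ R := by
    refine (uT_le_dist hf h0 hM hz y T).trans ?_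
    have h2 := norm_sub_le_norm_sub_add_norm_sub z x y
    have h3 : ‖x - y‖ < 1 := by
      rw [← dist_eq_norm, dist_comm]
      exact hy.2
    rw [hR]
    gcongr
    linarith
  have hexp1 : 0 ≤ 1 - Real.exp (-(lam * T)) := by
    rw [sub_nonneg, Real.exp_le_one_iff, neg_nonpos]
    exact mul_nonneg (le_of_lt hlam) hT0
  have h4 := mul_le_mul_of_nonneg_left hvR hexp1
  rw [Real.dist_eq, abs_of_nonneg (sub_nonneg.2 hup)]
  linarith [hyT.2]

end ControlProblem

/-- under assumptions (A), `u(·,t) - flo·t` converges locally uniformly as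
`t → +∞`, and the limit coincides with the locally uniform limit of `u_lam - flo/lam`
as `lam → 0⁺` (both limits existing). -/
theorem stmt8 {n : ℕ} (f : Euc n → ℝ) (flo fhi : ℝ)
    (hcont : Continuous f) (hlo : ∀ x, flo ≤ f x) (hhi : ∀ x, f x ≤ fhi)
    (hattain : ∃ x, f x = flo) :
    ∃ v : Euc n → ℝ,
      TendstoLocallyUniformly (fun (t : ℝ) (x : Euc n) => uT f x t - flo * t) v atTop ∧
      TendstoLocallyUniformly (fun (lam : ℝ) (x : Euc n) => uLam f lam x - flo / lam) v
        (𝓝[>] (0 : ℝ)) := by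
  obtain ⟨z, hz⟩ := hattain
  obtain ⟨v, hT, hL⟩ := exists_tendstoLocallyUniformly_of_min_zero (f := fun y => f y - flo)
    (M := fhi - flo) (z := z) (hcont.sub continuous_const) (fun x => sub_nonneg.2 (hlo x))
    (fun x => sub_le_sub_right (hhi x) flo) (sub_eq_zero.2 hz)
  refine ⟨v, tendstoLocallyUniformly_congr_eventually hT ?_,
    tendstoLocallyUniformly_congr_eventually hL ?_⟩
  · filter_upwards [eventually_ge_atTop 0] with t ht
    exact funext fun x => uT_sub_const hlo x ht
  · filter_upwards [self_mem_nhdsWithin] with lam hlam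
    exact funext fun x => uLam_sub_const hlo x hlam
end
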